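/- arXiv:2008.00663 — 2 statements merged into one kernel-verified Lean document; each statement's English description precedes it below -/
import Mathlib

section
/- Let m ≥ 3 be odd, q = 2^m, F = GF(q), and let f : F → F be an oval polynomial such that f(x^2) = f(x)^2 for all x ∈ F. Then every nonzero codeword of C_f has Hamming weight q-2, q-1, q, or q+1, and the numbers of codewords of these weights are: (q-1)(q-2) of weight q-2, (q-1)(q^2-5q+12)/2 of weight q-1, (q-1)(4q-5) of weight q, and (q-1)(q^2-3q+4)/2 of weight q+1. -/
/-- The Hamming weight of a vector: the number of nonzero coordinates. -/
def wt {ι F : Type} [Fintype ι] [DecidableEq F] [Zero F] (v : ι → F) : ℕ :=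
  (Finset.univ.filter fun i => v i ≠ 0).card

/-- The codeword of the code `C_f` of length `q+1` associated to `(a,b,c) ∈ F³`:
the vector `((a·f(x)+b·x+c)_{x ∈ F, x ≠ 0}, b+c, a+c)`. -/
def Cword {F : Type} [Field F] (f : F → F) (p : F × F × F) :
    {x : F // x ≠ 0} ⊕ Fin 2 → F :=
  Sum.elim (fun x => p.1 * f x.1 + p.2.1 * x.1 + p.2.2) ![p.2.1 + p.2.2, p.1 + p.2.2]

section OvalCode

variable {F : Type} [Field F]

/-- The affine points `(f x, x)`, `x ≠ 0`, together with `(0, 1)` and `(1, 0)`: the codeword of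
`(a, b, c)` evaluates `a u + b v + c` at these points. -/
def codePoint (f : F → F) : {x : F // x ≠ 0} ⊕ Fin 2 → F × F :=
  Sum.elim (fun x => (f x.1, x.1)) ![(0, 1), (1, 0)]

lemma Cword_apply (f : F → F) (p : F × F × F) (i : {x : F // x ≠ 0} ⊕ Fin 2) :
    Cword f p i = p.1 * (codePoint f i).1 + p.2.1 * (codePoint f i).2 + p.2.2 := by
  rcases i with x | j
  · rfl
  · fin_cases j <;> simp [Cword, codePoint]

lemma codePoint_injective {f : F → F} (hinj : Function.Injective f) (hf0 : f 0 = 0) :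
    Function.Injective (codePoint f) := by
  have hne : ∀ x : F, x ≠ 0 → f x ≠ 0 := fun x hx h => hx (hinj (h.trans hf0.symm))
  rintro (⟨x, hx⟩ | j) (⟨y, hy⟩ | k) h
  · simp_all [codePoint]
  · fin_cases k
    · exact absurd (congrArg Prod.fst h) (hne x hx)
    · exact absurd (congrArg Prod.snd h) hx
  · fin_cases j
    · exact absurd (congrArg Prod.fst h).symm (hne y hy)
    · exact absurd (congrArg Prod.snd h).symm hy
  · fin_cases j <;> fin_cases k <;> simp_all [codePoint]

lemma Cword_sub (f : F → F) (p p' : F × F × F) :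
    Cword f (p - p') = Cword f p - Cword f p' := by
  funext i
  simp only [Cword_apply, Pi.sub_apply, Prod.fst_sub, Prod.snd_sub]
  ring

lemma pow_sub_two_of_card [Fintype F] {q : ℕ} (hq : Fintype.card F = q) (hq2 : 2 < q) (t : F) :
    t ^ (q - 2) = t⁻¹ := by
  by_cases ht : t = 0
  · subst ht
    rw [zero_pow (by omega), inv_zero]
  · have h := FiniteField.pow_card_sub_one_eq_one t ht
    rw [hq, show q - 1 = (q - 2) + 1 by omega, pow_succ] at h
    exact eq_inv_of_mul_eq_one_left h

/-- A line of finite nonzero slope through a point of the graph of an oval polynomial meets the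
graph in exactly one further point. -/
lemma exists_second_root [Fintype F] [CharP F 2] {q : ℕ} (hq : Fintype.card F = q) (hq2 : 2 < q)
    {f : F → F}
    (hoval : ∀ a : F, Function.Bijective fun x : F => (f (x + a) + f a) * x ^ (q - 2))
    {a b c y : F} (ha : a ≠ 0) (hb : b ≠ 0) (hy : a * f y + b * y + c = 0) :
    ∃ z, z ≠ y ∧ a * f z + b * z + c = 0 ∧
      ∀ w, a * f w + b * w + c = 0 → w = y ∨ w = z := by
  simp only [pow_sub_two_of_card hq hq2] at hoval
  have h2 : (2 : F) = 0 := CharTwo.two_eq_zero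
  obtain ⟨t, ht⟩ := (hoval y).2 (b / a)
  have ht0 : t ≠ 0 := by
    rintro rfl
    simp [eq_comm, ha, hb] at ht
  refine ⟨t + y, by simpa using ht0, ?_, fun w hw => ?_⟩
  · simp only at ht
    field_simp at ht
    linear_combination ht + hy + (b * t - a * f y) * h2
  · by_cases hwy : w = y
    · exact Or.inl hwy
    · right
      have hwy' : w + y ≠ 0 := by rwa [Ne, CharTwo.add_eq_zero]
      have hw' : w + y + y = w := by linear_combination y * h2
      have : w + y = t := (hoval y).1 (by
        simp only at ht ⊢
        rw [ht, hw']
        field_simp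
        linear_combination hw + hy - (b * (w + y) + c) * h2)
      rw [← this, hw']

/-- The line `u + v = 1` misses the graph of an oval polynomial commuting with Frobenius, since
its intersection would be a Frobenius orbit of even order at most two. -/
lemma apply_add_self_add_one_ne_zero [Fintype F] [CharP F 2] {m : ℕ} (hm : 3 ≤ m)
    (hmodd : Odd m) (hcard : Fintype.card F = 2 ^ m) {f : F → F} (hf0 : f 0 = 0) (hf1 : f 1 = 1)
    (hoval : ∀ a : F, Function.Bijective fun x : F => (f (x + a) + f a) * x ^ (2 ^ m - 2))
    (hfrob : ∀ x : F, f (x ^ 2) = f x ^ 2) (x : F) : f x + x + 1 ≠ 0 := by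
  intro hx
  have h2 : (2 : F) = 0 := CharTwo.two_eq_zero
  have hq2 : 2 < 2 ^ m := by
    calc 2 < 2 ^ 3 := by norm_num
      _ ≤ 2 ^ m := Nat.pow_le_pow_right two_pos hm
  have hstep : ∀ y, f y + y + 1 = 0 → f (y ^ 2) + y ^ 2 + 1 = 0 := by
    intro y hy
    rw [hfrob]
    linear_combination (f y + y + 1) * hy - (f y * y + f y + y) * h2
  have hx2 := hstep x hx
  have hx4 := hstep _ hx2
  have hx0 : x ≠ 0 := by
    rintro rfl
    simp [hf0] at hx
  have hx1 : x ≠ 1 := by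
    rintro rfl
    rw [hf1, CharTwo.add_self_eq_zero, zero_add] at hx
    exact one_ne_zero hx
  have hsq : x ^ 2 ≠ x := by
    intro h
    exact hx1 (mul_left_cancel₀ hx0 (by linear_combination h))
  obtain ⟨z, -, -, huniq⟩ := exists_second_root (a := 1) (b := 1) (c := 1) hcard hq2 hoval
    one_ne_zero one_ne_zero (by simpa using hx)
  have hz : x ^ 2 = z := (huniq _ (by simpa using hx2)).resolve_left hsq
  rcases huniq _ (by simpa using hx4) with h | h
  · have h3 : x ^ 3 = 1 := mul_left_cancel₀ hx0 (by linear_combination h)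
    have hmod : 2 ^ m % 3 = 2 := by
      obtain ⟨k, rfl⟩ := hmodd
      rw [pow_succ, pow_mul, Nat.mul_mod, Nat.pow_mod]
      norm_num
    have hfix := FiniteField.pow_card x
    rw [hcard, ← Nat.div_add_mod (2 ^ m) 3, hmod, pow_add, pow_mul, h3, one_pow, one_mul] at hfix
    exact hsq hfix
  · rw [← hz] at h
    exact hsq (CharTwo.sq_injective h)

variable [Fintype F] [DecidableEq F]

/-- The affine part of the zero positions of a codeword. -/
def graphRoots (f : F → F) (p : F × F × F) : Finset F :=
  Finset.univ.filter fun x => x ≠ 0 ∧ p.1 * f x + p.2.1 * x + p.2.2 = 0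

/-- The zero positions of a codeword. -/
def zeroSet (f : F → F) (p : F × F × F) : Finset ({x : F // x ≠ 0} ⊕ Fin 2) :=
  Finset.univ.filter fun i => Cword f p i = 0

lemma card_zeroSet (f : F → F) (p : F × F × F) :
    (zeroSet f p).card = (graphRoots f p).card + (if p.2.1 + p.2.2 = 0 then 1 else 0) +
      (if p.1 + p.2.2 = 0 then 1 else 0) := by
  have h : (graphRoots f p).card = ∑ x : {x : F // x ≠ 0},
      if p.1 * f x.1 + p.2.1 * x.1 + p.2.2 = 0 then 1 else 0 := by
    rw [← Finset.sum_subtype (Finset.univ.filter fun x : F => x ≠ 0) (by simp)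
      (fun x : F => if p.1 * f x + p.2.1 * x + p.2.2 = 0 then 1 else 0), ← Finset.card_filter,
      Finset.filter_filter, graphRoots]
  rw [zeroSet, Finset.card_filter, Fintype.sum_sum_type, Fin.sum_univ_two, h, ← add_assoc]
  rfl

lemma card_index : Fintype.card ({x : F // x ≠ 0} ⊕ Fin 2) = Fintype.card F + 1 := by
  have := Fintype.card_pos (α := F)
  rw [Fintype.card_sum, Fintype.card_fin, Fintype.card_subtype_compl, Fintype.card_subtype_eq]
  omega

lemma wt_add_card_zeroSet (f : F → F) (p : F × F × F) :
    wt (Cword f p) + (zeroSet f p).card = Fintype.card F + 1 := by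
  rw [wt, zeroSet, add_comm, Finset.card_filter_add_card_filter_not, Finset.card_univ, card_index]

lemma card_line (u v : F) :
    (Finset.univ.filter fun p : F × F × F => p.1 * u + p.2.1 * v + p.2.2 = 0).card
      = Fintype.card F ^ 2 := by
  rw [sq, ← Fintype.card_prod, ← Finset.card_univ]
  refine Finset.card_bij' (fun p _ => (p.1, p.2.1)) (fun r _ => (r.1, r.2, -(r.1 * u + r.2 * v)))
    ?_ ?_ ?_ ?_
  · simp
  · simp
  · rintro ⟨a, b, c⟩ h
    simp only [Finset.mem_filter, Finset.mem_univ, true_and] at h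
    simp only [Prod.mk.injEq, true_and]
    linear_combination -h
  · simp

lemma card_line_inter {P Q : F × F} (hPQ : P ≠ Q) :
    (Finset.univ.filter fun p : F × F × F => p.1 * P.1 + p.2.1 * P.2 + p.2.2 = 0 ∧
      p.1 * Q.1 + p.2.1 * Q.2 + p.2.2 = 0).card = Fintype.card F := by
  obtain ⟨u, v⟩ := P
  obtain ⟨u', v'⟩ := Q
  rw [← Finset.card_univ]
  by_cases hu : u = u'
  · subst hu
    have hv : v - v' ≠ 0 := sub_ne_zero.2 fun h => hPQ (by rw [h])
    refine Finset.card_bij' (fun p _ => p.1) (fun a _ => (a, 0, -(a * u))) ?_ ?_ ?_ ?_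
    · simp
    · simp
    · rintro ⟨a, b, c⟩ h
      simp only [Finset.mem_filter, Finset.mem_univ, true_and] at h
      have hb : b = 0 := (mul_eq_zero.1
        (show b * (v - v') = 0 by linear_combination h.1 - h.2)).resolve_right hv
      subst hb
      simp only [Prod.mk.injEq, true_and]
      linear_combination -h.1
    · simp
  · have hu : u - u' ≠ 0 := sub_ne_zero.2 hu
    refine Finset.card_bij' (fun p _ => p.2.1)
      (fun b _ => (-(b * (v - v')) / (u - u'), b, (b * (v - v')) / (u - u') * u - b * v))
      ?_ ?_ ?_ ?_
    · simp
    · intro b _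
      simp only [Finset.mem_filter, Finset.mem_univ, true_and]
      constructor
      · field_simp
        ring
      · field_simp
        ring
    · rintro ⟨a, b, c⟩ h
      simp only [Finset.mem_filter, Finset.mem_univ, true_and] at h
      have ha : a = -(b * (v - v')) / (u - u') := by
        rw [eq_div_iff hu]
        linear_combination h.1 - h.2
      simp only [Prod.mk.injEq, true_and]
      refine ⟨ha.symm, ?_⟩
      have : (b * (v - v')) / (u - u') = -a := by rw [ha]; ring
      rw [this]
      linear_combination -h.1
    · simp

lemma sum_card_zeroSet (f : F → F) :
    ∑ p, (zeroSet f p).card = (Fintype.card F + 1) * Fintype.card F ^ 2 := by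
  simp only [zeroSet, Finset.card_filter]
  rw [Finset.sum_comm]
  simp_rw [← Finset.card_filter, Cword_apply, card_line, Finset.sum_const, Finset.card_univ,
    card_index, smul_eq_mul]

lemma sum_card_zeroSet_sq {f : F → F} (hinj : Function.Injective f) (hf0 : f 0 = 0) :
    ∑ p, (zeroSet f p).card ^ 2 = 2 * ((Fintype.card F + 1) * Fintype.card F ^ 2) := by
  have key : ∀ i j, (Finset.univ.filter fun p => Cword f p i = 0 ∧ Cword f p j = 0).card =
      Fintype.card F + if i = j then Fintype.card F ^ 2 - Fintype.card F else 0 := by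
    intro i j
    simp only [Cword_apply]
    split_ifs with h
    · subst h
      simp only [and_self, card_line]
      have : Fintype.card F ≤ Fintype.card F ^ 2 := Nat.le_self_pow two_ne_zero _
      omega
    · exact card_line_inter fun h' => h (codePoint_injective hinj hf0 h')
  have h1 : ∀ p, (zeroSet f p).card ^ 2 =
      ∑ i, ∑ j, if Cword f p i = 0 ∧ Cword f p j = 0 then 1 else 0 := by
    intro p
    rw [sq, zeroSet, Finset.card_filter, Finset.sum_mul_sum]
    simp only [ite_and, mul_ite, mul_one, mul_zero]
    refine Finset.sum_congr rfl fun i _ => Finset.sum_congr rfl fun j _ => ?_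
    split_ifs <;> rfl
  simp only [h1]
  rw [Finset.sum_comm]
  simp_rw [Finset.sum_comm (s := (Finset.univ : Finset (F × F × F))), ← Finset.card_filter, key,
    Finset.sum_add_distrib, Finset.sum_ite_eq, Finset.mem_univ, if_true, Finset.sum_const,
    Finset.card_univ, card_index, smul_eq_mul]
  have : Fintype.card F ≤ Fintype.card F ^ 2 := Nat.le_self_pow two_ne_zero _
  zify [this]
  ring

lemma card_zeroSet_zero (f : F → F) : (zeroSet f 0).card = Fintype.card F + 1 := by
  simp_rw [zeroSet, Cword_apply]
  rw [← card_index, ← Finset.card_univ]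
  simp

lemma mem_graphRoots {f : F → F} {p : F × F × F} {x : F} :
    x ∈ graphRoots f p ↔ x ≠ 0 ∧ p.1 * f x + p.2.1 * x + p.2.2 = 0 := by
  simp [graphRoots]

lemma card_graphRoots_le_one {f : F → F} (hinj : Function.Injective f) {p : F × F × F}
    (hp : p ≠ 0) (h : p.1 = 0 ∨ p.2.1 = 0) : (graphRoots f p).card ≤ 1 := by
  obtain ⟨a, b, c⟩ := p
  refine Finset.card_le_one.2 fun x hx y hy => ?_
  simp only [mem_graphRoots] at hx hy h
  have hxy : a * (f x - f y) + b * (x - y) = 0 := by linear_combination hx.2 - hy.2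
  rcases h with rfl | rfl
  · rcases mul_eq_zero.1 (show b * (x - y) = 0 by simpa using hxy) with rfl | h
    · exact absurd (by simpa using hx.2) (show c ≠ 0 by rintro rfl; exact hp rfl)
    · exact sub_eq_zero.1 h
  · rcases mul_eq_zero.1 (show a * (f x - f y) = 0 by simpa using hxy) with rfl | h
    · exact absurd (by simpa using hx.2) (show c ≠ 0 by rintro rfl; exact hp rfl)
    · exact hinj (sub_eq_zero.1 h)

lemma card_graphRoots_le_two [CharP F 2] {q : ℕ} (hq : Fintype.card F = q) (hq2 : 2 < q)
    {f : F → F} (hinj : Function.Injective f)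
    (hoval : ∀ a : F, Function.Bijective fun x : F => (f (x + a) + f a) * x ^ (q - 2))
    {p : F × F × F} (hp : p ≠ 0) : (graphRoots f p).card ≤ 2 := by
  by_cases h : p.1 = 0 ∨ p.2.1 = 0
  · exact (card_graphRoots_le_one hinj hp h).trans one_le_two
  rw [not_or] at h
  rcases (graphRoots f p).eq_empty_or_nonempty with he | ⟨y, hy⟩
  · simp [he]
  obtain ⟨z, -, -, hz⟩ := exists_second_root hq hq2 hoval h.1 h.2 (mem_graphRoots.1 hy).2
  refine (Finset.card_le_card (t := {y, z}) fun w hw => ?_).trans Finset.card_le_two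
  simpa using hz w (mem_graphRoots.1 hw).2

lemma two_le_card_graphRoots [CharP F 2] {q : ℕ} (hq : Fintype.card F = q) (hq2 : 2 < q)
    {f : F → F} (hf0 : f 0 = 0)
    (hoval : ∀ a : F, Function.Bijective fun x : F => (f (x + a) + f a) * x ^ (q - 2))
    {a b c x : F} (ha : a ≠ 0) (hb : b ≠ 0) (hc : c ≠ 0) (hx : a * f x + b * x + c = 0) :
    2 ≤ (graphRoots f (a, b, c)).card := by
  have hne : ∀ w, a * f w + b * w + c = 0 → w ≠ 0 := by
    rintro w hw rfl
    simp [hf0, hc] at hw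
  obtain ⟨z, hzx, hz, -⟩ := exists_second_root hq hq2 hoval ha hb hx
  rw [← Finset.card_pair hzx]
  refine Finset.card_le_card fun w hw => ?_
  rw [Finset.mem_insert, Finset.mem_singleton] at hw
  rcases hw with rfl | rfl
  · exact mem_graphRoots.2 ⟨hne _ hz, hz⟩
  · exact mem_graphRoots.2 ⟨hne _ hx, hx⟩

lemma graphRoots_self {f : F → F} (hline : ∀ x, f x + x + 1 ≠ 0) {b : F} (hb : b ≠ 0) :
    graphRoots f (b, b, b) = ∅ := by
  refine Finset.eq_empty_of_forall_notMem fun x hx => ?_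
  refine hline x (mul_left_cancel₀ hb ?_)
  linear_combination (mem_graphRoots.1 hx).2

lemma card_zeroSet_le_three [CharP F 2] {q : ℕ} (hq : Fintype.card F = q) (hq2 : 2 < q)
    {f : F → F} (hinj : Function.Injective f)
    (hoval : ∀ a : F, Function.Bijective fun x : F => (f (x + a) + f a) * x ^ (q - 2))
    (hline : ∀ x, f x + x + 1 ≠ 0) {p : F × F × F} (hp : p ≠ 0) :
    (zeroSet f p).card ≤ 3 := by
  have hle := card_graphRoots_le_two hq hq2 hinj hoval hp
  rw [card_zeroSet]
  split_ifs with hb ha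
  · obtain ⟨a, b, c⟩ := p
    simp only [CharTwo.add_eq_zero] at ha hb
    subst ha hb
    have hb0 : b ≠ 0 := by
      rintro rfl
      exact hp rfl
    have := graphRoots_self hline hb0
    simp [this]
  all_goals omega

lemma of_card_zeroSet_eq_three [CharP F 2] {q : ℕ} (hq : Fintype.card F = q) (hq2 : 2 < q)
    {f : F → F} (hinj : Function.Injective f)
    (hoval : ∀ a : F, Function.Bijective fun x : F => (f (x + a) + f a) * x ^ (q - 2))
    (hline : ∀ x, f x + x + 1 ≠ 0) {p : F × F × F} (h : (zeroSet f p).card = 3) :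
    p.1 ≠ 0 ∧ p.2.1 ≠ 0 ∧ (graphRoots f p).card = 2 ∧ p.1 ≠ p.2.1 ∧
      (p.2.1 = p.2.2 ∨ p.1 = p.2.2) := by
  have hp : p ≠ 0 := by
    rintro rfl
    rw [card_zeroSet_zero] at h
    omega
  have hle := card_graphRoots_le_two hq hq2 hinj hoval hp
  have hne : ¬ (p.2.1 = p.2.2 ∧ p.1 = p.2.2) := by
    obtain ⟨a, b, c⟩ := p
    rintro ⟨hb, ha⟩
    simp only at ha hb
    subst ha hb
    have hb0 : b ≠ 0 := by
      rintro rfl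
      exact hp rfl
    have := graphRoots_self hline hb0
    rw [card_zeroSet, this, Finset.card_empty] at h
    split_ifs at h
    all_goals omega
  have key : (graphRoots f p).card = 2 ∧ p.1 ≠ p.2.1 ∧ (p.2.1 = p.2.2 ∨ p.1 = p.2.2) := by
    rw [card_zeroSet] at h
    simp only [CharTwo.add_eq_zero] at h
    split_ifs at h with hb ha ha
    · exact absurd ⟨hb, ha⟩ hne
    · exact ⟨by omega, fun h' => ha (h'.trans hb), Or.inl hb⟩
    · exact ⟨by omega, fun h' => hb (h'.symm.trans ha), Or.inr ha⟩
    · omega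
  have h1 := card_graphRoots_le_one hinj hp
  refine ⟨fun h0 => ?_, fun h0 => ?_, key⟩
  · have := h1 (Or.inl h0)
    omega
  · have := h1 (Or.inr h0)
    omega

lemma card_params : ((Finset.univ.filter fun b : F => b ≠ 0) ×ˢ
    (Finset.univ.filter fun x : F => x ≠ 0 ∧ x ≠ 1)).card =
      (Fintype.card F - 1) * (Fintype.card F - 2) := by
  have h1 : (Finset.univ.filter fun b : F => b ≠ 0) = {0}ᶜ := by ext; simp
  have h2 : (Finset.univ.filter fun x : F => x ≠ 0 ∧ x ≠ 1) = {0, 1}ᶜ := by ext; simp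
  rw [Finset.card_product, h1, h2, Finset.card_compl, Finset.card_compl, Finset.card_singleton,
    Finset.card_pair zero_ne_one]

lemma two_mul_card_three_zeros_left [CharP F 2] {q : ℕ} (hq : Fintype.card F = q) (hq2 : 2 < q)
    {f : F → F} (hinj : Function.Injective f) (hf0 : f 0 = 0) (hf1 : f 1 = 1)
    (hoval : ∀ a : F, Function.Bijective fun x : F => (f (x + a) + f a) * x ^ (q - 2))
    (hline : ∀ x, f x + x + 1 ≠ 0) :
    2 * (Finset.univ.filter fun p => (zeroSet f p).card = 3 ∧ p.2.1 = p.2.2).card =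
      (q - 1) * (q - 2) := by
  have hne : ∀ x : F, x ≠ 0 → f x ≠ 0 := fun x hx h => hx (hinj (h.trans hf0.symm))
  rw [← hq, ← card_params, mul_comm]
  symm
  rw [Finset.card_eq_sum_card_fiberwise
    (f := fun r : F × F => (r.1 * (r.2 + 1) / f r.2, r.1, r.1))
    (t := Finset.univ.filter fun p => (zeroSet f p).card = 3 ∧ p.2.1 = p.2.2)]
  · rw [Finset.sum_const_nat]
    rintro ⟨a, b, c⟩ hp
    simp only [Finset.mem_filter, Finset.mem_univ, true_and] at hp
    obtain ⟨hp3, rfl⟩ := hp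
    obtain ⟨ha, hb, hcard, -⟩ := of_card_zeroSet_eq_three hq hq2 hinj hoval hline hp3
    rw [← hcard]
    refine Finset.card_bij' (fun r _ => r.2) (fun x _ => (b, x)) ?_ ?_ ?_ ?_
    · rintro ⟨b', x⟩ hr
      simp only [Finset.mem_filter, Finset.mem_product, Finset.mem_univ, true_and,
        Prod.mk.injEq] at hr
      obtain ⟨⟨-, hx, -⟩, rfl, rfl, -⟩ := hr
      have := hne x hx
      refine mem_graphRoots.2 ⟨hx, ?_⟩
      simp only
      field_simp
      linear_combination b' * (x + 1) * CharTwo.two_eq_zero (R := F)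
    · intro x hx
      obtain ⟨hx0, hx⟩ := mem_graphRoots.1 hx
      simp only at ha hb hx
      simp only [Finset.mem_filter, Finset.mem_product, Finset.mem_univ, true_and,
        Prod.mk.injEq, and_true]
      refine ⟨⟨hb, hx0, ?_⟩, ?_⟩
      · rintro rfl
        apply ha
        rw [hf1] at hx
        linear_combination hx - b * CharTwo.two_eq_zero (R := F)
      · rw [div_eq_iff (hne x hx0)]
        linear_combination hx - a * f x * CharTwo.two_eq_zero (R := F)
    · rintro ⟨b', x⟩ hr
      simp only [Finset.mem_filter, Prod.mk.injEq] at hr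
      rw [hr.2.2.1]
    · intro x _
      rfl
  · rintro ⟨b, x⟩ hr
    simp only [Finset.coe_product, Finset.coe_filter, Finset.mem_univ, true_and, Set.mem_prod,
      Set.mem_ofPred_eq] at hr ⊢
    obtain ⟨hb, hx0, hx1⟩ := hr
    have hfx := hne x hx0
    have hx1' : x + 1 ≠ 0 := by rwa [Ne, CharTwo.add_eq_zero]
    have h2 := two_le_card_graphRoots hq hq2 hf0 hoval (a := b * (x + 1) / f x) (b := b) (c := b)
      (x := x) (by positivity) hb hb (by
        field_simp
        linear_combination b * (x + 1) * CharTwo.two_eq_zero (R := F))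
    have h3 := card_zeroSet_le_three hq hq2 hinj hoval hline (p := (b * (x + 1) / f x, b, b))
      (fun h => hb (congrArg (fun p => p.2.1) h))
    rw [card_zeroSet, if_pos (CharTwo.add_self_eq_zero b)] at h3 ⊢
    exact ⟨by omega, trivial⟩

lemma two_mul_card_three_zeros_right [CharP F 2] {q : ℕ} (hq : Fintype.card F = q) (hq2 : 2 < q)
    {f : F → F} (hinj : Function.Injective f) (hf0 : f 0 = 0) (hf1 : f 1 = 1)
    (hoval : ∀ a : F, Function.Bijective fun x : F => (f (x + a) + f a) * x ^ (q - 2))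
    (hline : ∀ x, f x + x + 1 ≠ 0) :
    2 * (Finset.univ.filter fun p => (zeroSet f p).card = 3 ∧ p.1 = p.2.2).card =
      (q - 1) * (q - 2) := by
  rw [← hq, ← card_params, mul_comm]
  symm
  rw [Finset.card_eq_sum_card_fiberwise
    (f := fun r : F × F => (r.1, r.1 * (f r.2 + 1) / r.2, r.1))
    (t := Finset.univ.filter fun p => (zeroSet f p).card = 3 ∧ p.1 = p.2.2)]
  · rw [Finset.sum_const_nat]
    rintro ⟨a, b, c⟩ hp
    simp only [Finset.mem_filter, Finset.mem_univ, true_and] at hp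
    obtain ⟨hp3, rfl⟩ := hp
    obtain ⟨ha, hb, hcard, -⟩ := of_card_zeroSet_eq_three hq hq2 hinj hoval hline hp3
    rw [← hcard]
    refine Finset.card_bij' (fun r _ => r.2) (fun x _ => (a, x)) ?_ ?_ ?_ ?_
    · rintro ⟨a', x⟩ hr
      simp only [Finset.mem_filter, Finset.mem_product, Finset.mem_univ, true_and,
        Prod.mk.injEq] at hr
      obtain ⟨⟨-, hx, -⟩, rfl, rfl, -⟩ := hr
      refine mem_graphRoots.2 ⟨hx, ?_⟩
      simp only
      field_simp
      linear_combination a' * (f x + 1) * CharTwo.two_eq_zero (R := F)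
    · intro x hx
      obtain ⟨hx0, hx⟩ := mem_graphRoots.1 hx
      simp only at ha hb hx
      simp only [Finset.mem_filter, Finset.mem_product, Finset.mem_univ, true_and,
        Prod.mk.injEq, and_true]
      refine ⟨⟨ha, hx0, ?_⟩, ?_⟩
      · rintro rfl
        apply hb
        rw [hf1] at hx
        linear_combination hx - a * CharTwo.two_eq_zero (R := F)
      · rw [div_eq_iff hx0]
        linear_combination hx - b * x * CharTwo.two_eq_zero (R := F)
    · rintro ⟨a', x⟩ hr
      simp only [Finset.mem_filter, Prod.mk.injEq] at hr
      rw [hr.2.1]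
    · intro x _
      rfl
  · rintro ⟨a, x⟩ hr
    simp only [Finset.coe_product, Finset.coe_filter, Finset.mem_univ, true_and, Set.mem_prod,
      Set.mem_ofPred_eq] at hr ⊢
    obtain ⟨ha, hx0, hx1⟩ := hr
    have hfx : f x + 1 ≠ 0 := by
      rw [Ne, CharTwo.add_eq_zero, ← hf1]
      exact fun h => hx1 (hinj h)
    have h2 := two_le_card_graphRoots hq hq2 hf0 hoval (a := a) (b := a * (f x + 1) / x) (c := a)
      (x := x) ha (by positivity) ha (by
        field_simp
        linear_combination a * (f x + 1) * CharTwo.two_eq_zero (R := F))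
    have h3 := card_zeroSet_le_three hq hq2 hinj hoval hline (p := (a, a * (f x + 1) / x, a))
      (fun h => ha (congrArg (fun p => p.1) h))
    rw [card_zeroSet, if_pos (CharTwo.add_self_eq_zero a)] at h3 ⊢
    exact ⟨by omega, trivial⟩

lemma card_three_zeros [CharP F 2] {q : ℕ} (hq : Fintype.card F = q) (hq2 : 2 < q)
    {f : F → F} (hinj : Function.Injective f) (hf0 : f 0 = 0) (hf1 : f 1 = 1)
    (hoval : ∀ a : F, Function.Bijective fun x : F => (f (x + a) + f a) * x ^ (q - 2))
    (hline : ∀ x, f x + x + 1 ≠ 0) :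
    (Finset.univ.filter fun p => (zeroSet f p).card = 3).card = (q - 1) * (q - 2) := by
  have hl := two_mul_card_three_zeros_left hq hq2 hinj hf0 hf1 hoval hline
  have hr := two_mul_card_three_zeros_right hq hq2 hinj hf0 hf1 hoval hline
  have hunion : (Finset.univ.filter fun p => (zeroSet f p).card = 3) =
      (Finset.univ.filter fun p => (zeroSet f p).card = 3 ∧ p.2.1 = p.2.2) ∪
      (Finset.univ.filter fun p => (zeroSet f p).card = 3 ∧ p.1 = p.2.2) := by
    rw [← Finset.filter_or]
    refine Finset.filter_congr fun p _ => ⟨fun h => ?_, fun h => h.elim And.left And.left⟩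
    rw [← and_or_left]
    exact ⟨h, (of_card_zeroSet_eq_three hq hq2 hinj hoval hline h).2.2.2.2⟩
  rw [hunion, Finset.card_union_of_disjoint]
  · omega
  · refine Finset.disjoint_filter.2 fun p _ h h' => ?_
    exact (of_card_zeroSet_eq_three hq hq2 hinj hoval hline h.1).2.2.2.1 (h'.2.trans h.2.symm)

lemma sum_comp_card_zeroSet {f : F → F} (hF : 3 ≤ Fintype.card F)
    (hle : ∀ p, p ≠ 0 → (zeroSet f p).card ≤ 3) (g : ℕ → ℕ) :
    ∑ p, g (zeroSet f p).card = g (Fintype.card F + 1) +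
      ∑ k ∈ Finset.range 4, g k * (Finset.univ.filter fun p => (zeroSet f p).card = k).card := by
  have h : ∀ p, g (zeroSet f p).card = (if p = 0 then g (Fintype.card F + 1) else 0) +
      ∑ k ∈ Finset.range 4, if (zeroSet f p).card = k then g k else 0 := by
    intro p
    rw [Finset.sum_ite_eq]
    split_ifs with h0 hk hk
    · subst h0
      rw [card_zeroSet_zero, Finset.mem_range] at hk
      omega
    · rw [h0, card_zeroSet_zero, add_zero]
    · rw [zero_add]
    · exact absurd (Finset.mem_range.2 (Nat.lt_succ_of_le (hle p h0))) hk
  simp_rw [h]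
  rw [Finset.sum_add_distrib, Finset.sum_ite_eq', if_pos (Finset.mem_univ _), Finset.sum_comm]
  simp_rw [← Finset.sum_filter, Finset.sum_const, smul_eq_mul, mul_comm]

lemma Cword_injective {f : F → F} (hF : 3 ≤ Fintype.card F)
    (hle : ∀ p, p ≠ 0 → (zeroSet f p).card ≤ 3) : Function.Injective (Cword f) := by
  intro p p' h
  by_contra hne
  have h0 : Cword f (p - p') = 0 := by rw [Cword_sub, h, sub_self]
  have h3 := hle _ (sub_ne_zero.2 hne)
  rw [zeroSet, h0] at h3
  simp only [Pi.zero_apply, Finset.filter_true, Finset.card_univ, card_index] at h3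
  omega

lemma card_codewords_of_weight {f : F → F} (hinj : Function.Injective (Cword f)) {w k : ℕ}
    (hwk : w + k = Fintype.card F + 1) :
    Nat.card {v : {x : F // x ≠ 0} ⊕ Fin 2 → F // (∃ p : F × F × F, v = Cword f p) ∧ wt v = w} =
      (Finset.univ.filter fun p => (zeroSet f p).card = k).card := by
  rw [← Fintype.card_subtype, ← Nat.card_eq_fintype_card]
  have hw : ∀ p, (zeroSet f p).card = k ↔ wt (Cword f p) = w := by
    intro p
    have h := wt_add_card_zeroSet f p
    omega
  refine (Nat.card_eq_of_bijective
    (fun p => ⟨Cword f p.1, ⟨p.1, rfl⟩, (hw p.1).1 p.2⟩) ⟨?_, ?_⟩).symm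
  · exact fun p p' h => Subtype.ext (hinj (Subtype.ext_iff.1 h))
  · rintro ⟨_, ⟨p, rfl⟩, hp⟩
    exact ⟨⟨p, (hw p).2 hp⟩, rfl⟩

end OvalCode

/-- **Theorem (weight distribution of `C_f`).**  Let `m ≥ 3` be odd, `q = 2^m`,
`F = GF(q)` and let `f` be an oval polynomial over `F` with `f(x²) = f(x)²`
for all `x`.  Then every nonzero codeword of `C_f` has Hamming weight `q-2`,
`q-1`, `q` or `q+1`, and the numbers of codewords of those weights are
`(q-1)(q-2)`, `(q-1)(q²-5q+12)/2`, `(q-1)(4q-5)` and `(q-1)(q²-3q+4)/2`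
respectively. -/
theorem stmt_12 (m : ℕ) (hm : 3 ≤ m) (hmodd : Odd m)
    (F : Type) [Field F] [Fintype F] [DecidableEq F] (hcard : Fintype.card F = 2 ^ m)
    (f : F → F)
    (hbij : Function.Bijective f) (hf0 : f 0 = 0) (hf1 : f 1 = 1)
    (hoval : ∀ a : F, Function.Bijective fun x : F => (f (x + a) + f a) * x ^ (2 ^ m - 2))
    (hfrob : ∀ x : F, f (x ^ 2) = f x ^ 2) :
    (∀ v : {x : F // x ≠ 0} ⊕ Fin 2 → F, (∃ p : F × F × F, v = Cword f p) →
        v ≠ 0 → wt v = 2 ^ m - 2 ∨ wt v = 2 ^ m - 1 ∨ wt v = 2 ^ m ∨ wt v = 2 ^ m + 1)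
    ∧ Nat.card {v : {x : F // x ≠ 0} ⊕ Fin 2 → F //
          (∃ p : F × F × F, v = Cword f p) ∧ wt v = 2 ^ m - 2}
        = (2 ^ m - 1) * (2 ^ m - 2)
    ∧ 2 * Nat.card {v : {x : F // x ≠ 0} ⊕ Fin 2 → F //
          (∃ p : F × F × F, v = Cword f p) ∧ wt v = 2 ^ m - 1}
        = (2 ^ m - 1) * ((2 ^ m) ^ 2 - 5 * 2 ^ m + 12)
    ∧ Nat.card {v : {x : F // x ≠ 0} ⊕ Fin 2 → F //
          (∃ p : F × F × F, v = Cword f p) ∧ wt v = 2 ^ m}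
        = (2 ^ m - 1) * (4 * 2 ^ m - 5)
    ∧ 2 * Nat.card {v : {x : F // x ≠ 0} ⊕ Fin 2 → F //
          (∃ p : F × F × F, v = Cword f p) ∧ wt v = 2 ^ m + 1}
        = (2 ^ m - 1) * ((2 ^ m) ^ 2 - 3 * 2 ^ m + 4) := by

  have hq8 : 8 ≤ 2 ^ m := by
    calc 8 = 2 ^ 3 := by norm_num
      _ ≤ 2 ^ m := Nat.pow_le_pow_right two_pos hm
  have : CharP F 2 := by
    refine CharTwo.of_one_ne_zero_of_two_eq_zero one_ne_zero ?_
    have h := FiniteField.cast_card_eq_zero F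
    rw [hcard, Nat.cast_pow, Nat.cast_two] at h
    exact eq_zero_of_pow_eq_zero h
  have hline := apply_add_self_add_one_ne_zero hm hmodd hcard hf0 hf1 hoval hfrob
  have hle : ∀ p, p ≠ 0 → (zeroSet f p).card ≤ 3 := fun p hp =>
    card_zeroSet_le_three hcard (by omega) hbij.1 hoval hline hp
  have hinj := Cword_injective (by omega) hle
  have e0 := sum_comp_card_zeroSet (by omega) hle fun _ => 1
  have e1 := sum_comp_card_zeroSet (by omega) hle fun k => k
  have e2 := sum_comp_card_zeroSet (by omega) hle fun k => k ^ 2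
  have e3 := card_three_zeros hcard (by omega) hbij.1 hf0 hf1 hoval hline
  rw [sum_card_zeroSet] at e1
  rw [sum_card_zeroSet_sq hbij.1 hf0] at e2
  rw [Finset.sum_const, Finset.card_univ, Fintype.card_prod, Fintype.card_prod] at e0
  simp only [Finset.sum_range_succ, Finset.sum_range_zero, e3, hcard, smul_eq_mul] at e0 e1 e2
  refine ⟨?_, ?_, ?_, ?_, ?_⟩
  · rintro _ ⟨p, rfl⟩ hv
    have hp : p ≠ 0 := by
      rintro rfl
      exact hv (by simpa using Cword_sub f 0 0)
    have h1 := wt_add_card_zeroSet f p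
    have h2 := hle p hp
    omega
  · rw [card_codewords_of_weight hinj (k := 3) (by omega), e3]
  · rw [card_codewords_of_weight hinj (k := 2) (by omega)]
    obtain ⟨r, hr⟩ := Nat.exists_eq_add_of_le' hq8
    rw [hr, show (r + 8) ^ 2 - 5 * (r + 8) + 12 = r ^ 2 + 11 * r + 36 by
      rw [show (r + 8) ^ 2 = r ^ 2 + 11 * r + 24 + 5 * (r + 8) by ring, Nat.add_sub_cancel]]
    rw [hr] at e0 e1 e2
    simp only [Nat.add_succ_sub_one, Nat.reduceSubDiff] at e0 e1 e2 ⊢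
    zify at e0 e1 e2 ⊢
    linear_combination e1 - e2
  · rw [card_codewords_of_weight hinj (k := 1) (by omega)]
    obtain ⟨r, hr⟩ := Nat.exists_eq_add_of_le' hq8
    rw [hr, show 4 * (r + 8) - 5 = 4 * r + 27 by omega]
    rw [hr] at e0 e1 e2
    simp only [Nat.add_succ_sub_one, Nat.reduceSubDiff] at e0 e1 e2 ⊢
    zify at e0 e1 e2 ⊢
    linear_combination e2 - 2 * e1
  · rw [card_codewords_of_weight hinj (k := 0) (by omega)]
    obtain ⟨r, hr⟩ := Nat.exists_eq_add_of_le' hq8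
    rw [hr, show (r + 8) ^ 2 - 3 * (r + 8) + 4 = r ^ 2 + 13 * r + 44 by
      rw [show (r + 8) ^ 2 = r ^ 2 + 13 * r + 40 + 3 * (r + 8) by ring, Nat.add_sub_cancel]]
    rw [hr] at e0 e1 e2
    simp only [Nat.add_succ_sub_one, Nat.reduceSubDiff] at e0 e1 e2 ⊢
    zify at e0 e1 e2 ⊢
    linear_combination -2 * e0 + 3 * e1 - e2
end

section
/- Let m ≥ 3 be odd, q = 2^m, F = GF(q), and let f : F → F be an oval polynomial such that f(x^2) = f(x)^2 for all x ∈ F. Then the code C̄_f is a near MDS code with parameters [q+2, 3, q-1]: the map (a,b,c) ↦ codeword is injective (so C̄_f has dimension 3), the minimum Hamming weight of a nonzero codeword of C̄_f is q-1, and the minimum Hamming weight of a nonzero codeword of the dual code C̄_f^⊥ is 3. -/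
/-- The codeword of the code `C̄_f` of length `q+2` associated to `(a,b,c) ∈ F³`:
the vector `((a·f(x)+b·x+c)_{x ∈ F}, b+c, a+c)`. -/
def Cbarword {F : Type} [Field F] (f : F → F) (p : F × F × F) : F ⊕ Fin 2 → F :=
  Sum.elim (fun x => p.1 * f x + p.2.1 * x + p.2.2) ![p.2.1 + p.2.2, p.1 + p.2.2]

/-- The affine coordinates of the points underlying the columns of `C̄_f`. -/
def columnPoint {F : Type} [Field F] (f : F → F) : F ⊕ Fin 2 → F × F :=
  Sum.elim (fun x => (f x, x)) ![(0, 1), (1, 0)]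

lemma Cbarword_apply {F : Type} [Field F] (f : F → F) (p : F × F × F) (i : F ⊕ Fin 2) :
    Cbarword f p i = p.1 * (columnPoint f i).1 + p.2.1 * (columnPoint f i).2 + p.2.2 := by
  rcases i with x | i
  · rfl
  · fin_cases i <;> simp [Cbarword, columnPoint]

lemma columnPoint_injective {F : Type} [Field F] (f : F → F) (hf0 : f 0 = 0) (hf1 : f 1 = 1) :
    Function.Injective (columnPoint f) := by
  rintro (x | i) (y | j) h
  · simp only [columnPoint, Sum.elim_inl, Prod.mk.injEq] at h
    rw [h.2]
  · fin_cases j <;> simp [columnPoint] at h <;> obtain ⟨h1, rfl⟩ := h <;> simp_all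
  · fin_cases i <;> simp [columnPoint] at h <;> obtain ⟨h1, rfl⟩ := h <;> simp_all
  · fin_cases i <;> fin_cases j <;> simp [columnPoint] at h ⊢

lemma Cbarword_injective {F : Type} [Field F] (f : F → F) (hf0 : f 0 = 0) :
    Function.Injective (Cbarword f) := by
  rintro ⟨a, b, c⟩ ⟨a', b', c'⟩ h
  have h0 := congrFun h (Sum.inl 0)
  have h1 := congrFun h (Sum.inr 0)
  have h2 := congrFun h (Sum.inr 1)
  simp [Cbarword, hf0] at h0 h1 h2
  subst h0
  simp at h1 h2
  simp [h1, h2]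

/-- A vector orthogonal to all affine functions on a set of distinct points has weight at least
three. -/
lemma three_le_wt_of_orthogonal {ι F : Type} [Fintype ι] [Field F] [DecidableEq F]
    (P : ι → F × F) (hP : Function.Injective P) (v : ι → F)
    (hv : ∀ p : F × F × F, ∑ i, v i * (p.1 * (P i).1 + p.2.1 * (P i).2 + p.2.2) = 0)
    (hv0 : v ≠ 0) : 3 ≤ wt v := by
  classical
  by_contra! hlt
  obtain ⟨i, hi⟩ := Function.ne_iff.mp hv0
  have : Nonempty ι := ⟨i⟩
  have hmem : i ∈ Finset.univ.filter fun k => v k ≠ 0 := by simpa using hi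
  have hcard : ((Finset.univ.filter fun k => v k ≠ 0).erase i).card ≤ 1 := by
    rw [Finset.card_erase_of_mem hmem]
    unfold wt at hlt
    omega
  obtain ⟨j, hj⟩ := Finset.card_le_one_iff_subset_singleton.mp hcard
  have hsupp : ∀ k, k ≠ i → k ≠ j → v k = 0 := by
    intro k hki hkj
    by_contra hk
    have : k ∈ ({j} : Finset ι) := hj (by simp [hki, hk])
    exact hkj (by simpa using this)
  obtain ⟨p, hpj, hpi⟩ : ∃ p : F × F × F,
      (j ≠ i → p.1 * (P j).1 + p.2.1 * (P j).2 + p.2.2 = 0) ∧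
      p.1 * (P i).1 + p.2.1 * (P i).2 + p.2.2 ≠ 0 := by
    by_cases hji : j = i
    · exact ⟨(0, 0, 1), fun h => absurd hji h, by simp⟩
    by_cases hX : (P i).1 = (P j).1
    · refine ⟨(0, 1, -(P j).2), fun _ => by simp, ?_⟩
      have hY : (P i).2 ≠ (P j).2 := fun hY => hji (hP (Prod.ext hX hY)).symm
      simpa [← sub_eq_add_neg, sub_eq_zero] using hY
    · exact ⟨(1, 0, -(P j).1), fun _ => by simp,
        by simpa [← sub_eq_add_neg, sub_eq_zero] using hX⟩
  have hsum := hv p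
  rw [Finset.sum_eq_single i] at hsum
  · exact (mul_ne_zero hi hpi) hsum
  · intro k _ hki
    by_cases hkj : k = j
    · subst hkj
      rw [hpj hki, mul_zero]
    · rw [hsupp k hki hkj, zero_mul]
  · simp

lemma two_eq_zero_of_card {F : Type} [Field F] [Fintype F] {m : ℕ}
    (hcard : Fintype.card F = 2 ^ m) : (2 : F) = 0 := by
  have h := FiniteField.cast_card_eq_zero F
  rw [hcard] at h
  push_cast at h
  exact eq_zero_of_pow_eq_zero h

lemma pow_card_sub_two {F : Type} [Field F] [Fintype F] {q : ℕ} (hq : 2 ≤ q)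
    (hcard : Fintype.card F = q) {x : F} (hx : x ≠ 0) : x ^ (q - 2) = x⁻¹ := by
  have h := FiniteField.pow_card_sub_one_eq_one x hx
  rw [hcard, show q - 1 = (q - 2) + 1 by omega, pow_succ] at h
  exact eq_inv_of_mul_eq_one_left h

/-- The secants from a point of the graph of `f` have pairwise distinct nonzero slopes, and every
nonzero slope occurs. -/
def IsOval {F : Type} [Field F] (f : F → F) : Prop :=
  (∀ x y z : F, y ≠ x → z ≠ x → (f y + f x) / (y + x) = (f z + f x) / (z + x) → y = z) ∧
  ∀ x s : F, s ≠ 0 → ∃ y, y ≠ x ∧ f y + f x = s * (y + x)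

lemma isOval_of_bijective {F : Type} [Field F] [Fintype F] {q : ℕ} (hq : 3 ≤ q)
    (hcard : Fintype.card F = q) (h2 : (2 : F) = 0) (f : F → F)
    (hoval : ∀ a : F, Function.Bijective fun x : F => (f (x + a) + f a) * x ^ (q - 2)) :
    IsOval f := by
  have hadd (x y : F) : x + y = 0 ↔ x = y :=
    ⟨fun h => by linear_combination h - y * h2, fun h => by linear_combination h + y * h2⟩
  have hcancel (x y : F) : x + y + y = x := by linear_combination y * h2
  constructor
  · intro x y z hy hz h
    have hy' : y + x ≠ 0 := by rwa [Ne, hadd]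
    have hz' : z + x ≠ 0 := by rwa [Ne, hadd]
    have := (hoval x).injective (a₁ := y + x) (a₂ := z + x) (by
      simp only [hcancel]
      rw [pow_card_sub_two (by omega) hcard hy', pow_card_sub_two (by omega) hcard hz',
        ← div_eq_mul_inv, ← div_eq_mul_inv, h])
    exact add_right_cancel this
  · intro x s hs
    obtain ⟨t, ht⟩ := (hoval x).surjective s
    dsimp only at ht
    have ht0 : t ≠ 0 := by
      rintro rfl
      rw [zero_pow (by omega), mul_zero] at ht
      exact hs ht.symm
    rw [pow_card_sub_two (by omega) hcard ht0] at ht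
    refine ⟨t + x, by simpa using ht0, ?_⟩
    rw [hcancel, ← ht]
    field_simp

/-- No three points of the graph are collinear. -/
lemma IsOval.coeff_eq_zero {F : Type} [Field F] {f : F → F} (hf : IsOval f)
    (h2 : (2 : F) = 0) {a b c x y z : F} (hxy : y ≠ x) (hxz : z ≠ x) (hyz : y ≠ z)
    (hx : a * f x + b * x + c = 0) (hy : a * f y + b * y + c = 0)
    (hz : a * f z + b * z + c = 0) : a = 0 ∧ b = 0 ∧ c = 0 := by
  have hadd (x y : F) : x + y = 0 ↔ x = y :=
    ⟨fun h => by linear_combination h - y * h2, fun h => by linear_combination h + y * h2⟩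
  have ha : a = 0 := by
    by_contra ha
    have hy' : y + x ≠ 0 := by rwa [Ne, hadd]
    have hz' : z + x ≠ 0 := by rwa [Ne, hadd]
    refine hyz (hf.1 x y z hxy hxz ?_)
    trans -b / a
    · rw [div_eq_div_iff hy' ha]
      linear_combination hx + hy - c * h2
    · rw [div_eq_div_iff ha hz']
      linear_combination -hx - hz + c * h2
  subst ha
  have hb : b = 0 := by
    have : b * (y - x) = 0 := by linear_combination hy - hx
    exact (mul_eq_zero.mp this).resolve_right (sub_ne_zero.mpr hxy)
  subst hb
  simpa using hx

lemma IsOval.card_zeros_le_two {F : Type} [Field F] [Fintype F] [DecidableEq F] {f : F → F}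
    (hf : IsOval f) (h2 : (2 : F) = 0) (a b c : F) (h : ¬ (a = 0 ∧ b = 0 ∧ c = 0)) :
    (Finset.univ.filter fun x => a * f x + b * x + c = 0).card ≤ 2 := by
  by_contra! hlt
  obtain ⟨x, y, z, hx, hy, hz, hxy, hxz, hyz⟩ := Finset.two_lt_card_iff.mp hlt
  simp only [Finset.mem_filter, Finset.mem_univ, true_and] at hx hy hz
  exact h (hf.coeff_eq_zero h2 hxy.symm hxz.symm hyz hx hy hz)

lemma eq_sq_of_eq_pow_four {F : Type} [Field F] [Fintype F] {m : ℕ} (hm : Odd m)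
    (hcard : Fintype.card F = 2 ^ m) {x : F} (hx : x ^ 4 = x) : x ^ 2 = x := by
  obtain ⟨k, rfl⟩ := hm
  have hk : ∀ n : ℕ, x ^ 4 ^ n = x := by
    intro n
    induction n with
    | zero => simp
    | succ n ih => rw [pow_succ, pow_mul, ih, hx]
  have h := FiniteField.pow_card x
  rwa [hcard, pow_succ, pow_mul 2 2 k, pow_mul, show (2 ^ 2 : ℕ) = 4 by norm_num, hk] at h

/-- The line joining the two additional points misses the graph of `f`. -/
lemma IsOval.add_ne_one {F : Type} [Field F] [Fintype F] {m : ℕ} (hm : Odd m)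
    (hcard : Fintype.card F = 2 ^ m) (h2 : (2 : F) = 0) {f : F → F} (hf : IsOval f)
    (hf0 : f 0 = 0) (hf1 : f 1 = 1) (hfrob : ∀ x : F, f (x ^ 2) = f x ^ 2) (x : F) :
    f x + x + 1 ≠ 0 := by
  intro hx
  have hsq : ∀ y : F, f y + y + 1 = 0 → f (y ^ 2) + y ^ 2 + 1 = 0 := by
    intro y hy
    rw [hfrob]
    linear_combination (f y + y + 1) * hy - (f y * y + f y + y) * h2
  have hne : x ^ 2 ≠ x := by
    intro h
    have : x * (x - 1) = 0 := by linear_combination h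
    rcases mul_eq_zero.mp this with rfl | h
    · simp [hf0] at hx
    · rw [sub_eq_zero] at h
      subst h
      rw [hf1] at hx
      exact one_ne_zero (by linear_combination hx - h2 : (1 : F) = 0)
  have hne' : (x ^ 2) ^ 2 ≠ x := fun h =>
    hne (eq_sq_of_eq_pow_four hm hcard (by linear_combination h))
  have hne'' : x ^ 2 ≠ (x ^ 2) ^ 2 := by
    intro h
    apply hne
    have : (x ^ 2 - x) ^ 2 = 0 := by linear_combination -h + (x ^ 2 - x ^ 3) * h2
    exact sub_eq_zero.mp (eq_zero_of_pow_eq_zero this)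
  have h := hf.coeff_eq_zero h2 (a := 1) (b := 1) (c := 1) hne hne' hne''
    (by simpa using hx) (by simpa using hsq x hx) (by simpa using hsq _ (hsq x hx))
  exact one_ne_zero h.1

lemma wt_add_card_zeros {F : Type} [Field F] [Fintype F] [DecidableEq F] (v : F ⊕ Fin 2 → F) :
    wt v + (Finset.univ.filter fun i => v i = 0).card = Fintype.card F + 2 := by
  have h := Finset.card_filter_add_card_filter_not (s := Finset.univ) (fun i => v i = 0)
  simp only [Finset.card_univ, Fintype.card_sum, Fintype.card_fin] at h
  rw [← h, add_comm]
  rfl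

lemma card_zeros_Cbarword {F : Type} [Field F] [Fintype F] [DecidableEq F] (f : F → F)
    (a b c : F) :
    (Finset.univ.filter fun i => Cbarword f (a, b, c) i = 0).card =
      (Finset.univ.filter fun x => a * f x + b * x + c = 0).card +
        ((if b + c = 0 then 1 else 0) + if a + c = 0 then 1 else 0) := by
  simp only [Finset.card_filter, Fintype.sum_sum_type, Fin.sum_univ_two]
  rfl

lemma card_zeros_Cbarword_le_three {F : Type} [Field F] [Fintype F] [DecidableEq F] {f : F → F}
    (hf : IsOval f) (h2 : (2 : F) = 0) (hline : ∀ x, f x + x + 1 ≠ 0) (a b c : F)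
    (h : ¬ (a = 0 ∧ b = 0 ∧ c = 0)) :
    (Finset.univ.filter fun i => Cbarword f (a, b, c) i = 0).card ≤ 3 := by
  rw [card_zeros_Cbarword]
  have hle := hf.card_zeros_le_two h2 a b c h
  by_cases hb : b + c = 0
  · by_cases ha : a + c = 0
    · obtain rfl : a = c := by linear_combination ha - c * h2
      obtain rfl : b = a := by linear_combination hb - a * h2
      have hempty : (Finset.univ.filter fun x => b * f x + b * x + b = 0) = ∅ := by
        refine Finset.filter_eq_empty_iff.mpr fun x _ hx => ?_
        have : b * (f x + x + 1) = 0 := by linear_combination hx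
        have hb0 := (mul_eq_zero.mp this).resolve_right (hline x)
        exact h ⟨hb0, hb0, hb0⟩
      rw [hempty]
      simp [ha]
    · simp only [hb, ha, if_true, if_false]
      omega
  · simp only [hb, if_false]
    split_ifs <;> omega

/-- Some secant through the point `(0, 1)` meets the graph of `f` in two points. -/
lemma IsOval.exists_secant {F : Type} [Field F] [Fintype F] (hcard : 2 < Fintype.card F)
    (h2 : (2 : F) = 0) {f : F → F} (hf : IsOval f) (hinj : Function.Injective f)
    (hf0 : f 0 = 0) :
    ∃ a x y : F, y ≠ x ∧ x ≠ 1 ∧ y ≠ 1 ∧ a * f x + x + 1 = 0 ∧ a * f y + y + 1 = 0 := by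
  classical
  have hadd (x y : F) : x + y = 0 ↔ x = y :=
    ⟨fun h => by linear_combination h - y * h2, fun h => by linear_combination h + y * h2⟩
  obtain ⟨x, hx⟩ : ∃ x : F, x ∉ ({0, 1} : Finset F) := by
    by_contra! hall
    have := Finset.card_le_card (fun x _ => hall x : (Finset.univ : Finset F) ⊆ {0, 1})
    rw [Finset.card_univ] at this
    have := Finset.card_le_two (a := (0 : F)) (b := 1)
    omega
  simp only [Finset.mem_insert, Finset.mem_singleton, not_or] at hx
  have hfx : f x ≠ 0 := fun h => hx.1 (hinj (h.trans hf0.symm))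
  have hx1 : x + 1 ≠ 0 := by rw [Ne, hadd]; exact hx.2
  obtain ⟨y, hyx, hy⟩ := hf.2 x (f x / (x + 1)) (div_ne_zero hfx hx1)
  have hline : (x + 1) / f x * f y + y + 1 = 0 := by
    field_simp at hy ⊢
    linear_combination hy + f x * y * h2
  refine ⟨(x + 1) / f x, x, y, hyx, hx.2, ?_, ?_, hline⟩
  · rintro rfl
    have hz : (x + 1) / f x * f 1 = 0 := by linear_combination hline - h2
    have hf1 := (mul_eq_zero.mp hz).resolve_left (div_ne_zero hx1 hfx)
    exact one_ne_zero (hinj (hf1.trans hf0.symm))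
  · rw [div_mul_cancel₀ _ hfx]
    linear_combination (x + 1) * h2

/-- Three collinear points yield an orthogonal vector of weight three. -/
lemma exists_orthogonal_wt_eq_three {F : Type} [Field F] [Fintype F] [DecidableEq F]
    {f : F → F} {a x y : F} (ha : a ≠ 0) (hyx : y ≠ x) (hx1 : x ≠ 1) (hy1 : y ≠ 1)
    (hx : a * f x = 1 - x) (hy : a * f y = 1 - y) :
    ∃ v : F ⊕ Fin 2 → F, (∀ p : F × F × F, ∑ i, v i * Cbarword f p i = 0) ∧
      v ≠ 0 ∧ wt v = 3 := by
  let w : F → F := Function.update (Function.update 0 x (1 - y)) y (x - 1)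
  let v : F ⊕ Fin 2 → F := Sum.elim w ![y - x, 0]
  have hwx : w x = 1 - y := by simp [w, hyx.symm]
  have hwy : w y = x - 1 := by simp [w]
  have hw0 : ∀ z, z ≠ y ∧ z ≠ x → w z = 0 := fun z hz => by simp [w, hz.1, hz.2]
  have hwt : wt v = 3 := by
    have hsupp : (Finset.univ.filter fun i => v i ≠ 0) = {Sum.inl y, Sum.inl x, Sum.inr 0} := by
      ext (z | i)
      · by_cases hzy : z = y
        · subst hzy; simp [v, hwy, sub_ne_zero.mpr hx1]
        · by_cases hzx : z = x
          · subst hzx; simp [v, hwx, sub_ne_zero.mpr hy1.symm]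
          · simp [v, hw0 z ⟨hzy, hzx⟩, hzy, hzx]
      · fin_cases i <;> simp [v, sub_ne_zero.mpr hyx]
    rw [wt, hsupp, Finset.card_eq_three.mpr
      ⟨Sum.inl y, Sum.inl x, Sum.inr 0, by simpa using hyx, by simp, by simp, rfl⟩]
  refine ⟨v, fun p => ?_, ?_, hwt⟩
  · rw [Fintype.sum_sum_type, Fin.sum_univ_two,
      Fintype.sum_eq_add y x hyx (fun z hz => by simp [v, hw0 z hz])]
    simp only [v, Sum.elim_inl, Sum.elim_inr, Cbarword, hwx, hwy, Matrix.cons_val_zero,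
      Matrix.cons_val_one]
    refine mul_left_cancel₀ ha ?_
    linear_combination p.1 * (1 - y) * hx + p.1 * (x - 1) * hy
  · rintro hv
    simp [hv, wt] at hwt

/-- **Theorem (Theorem `thm-nmdscodej232`).**  Let `m ≥ 3` be odd, `q = 2^m`,
`F = GF(q)` and let `f` be an oval polynomial over `F` with `f(x²) = f(x)²`
for all `x`.  Then `C̄_f` is an NMDS code with parameters `[q+2, 3, q-1]`: the
encoding map is injective (so the dimension is `3`), the minimum Hamming
weight of a nonzero codeword of `C̄_f` is `q-1`, and the minimum Hamming weight
of a nonzero codeword of the dual code `C̄_f^⊥` is `3`. -/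
theorem stmt_15 (m : ℕ) (hm : 3 ≤ m) (hmodd : Odd m)
    (F : Type) [Field F] [Fintype F] [DecidableEq F] (hcard : Fintype.card F = 2 ^ m)
    (f : F → F)
    (hbij : Function.Bijective f) (hf0 : f 0 = 0) (hf1 : f 1 = 1)
    (hoval : ∀ a : F, Function.Bijective fun x : F => (f (x + a) + f a) * x ^ (2 ^ m - 2))
    (hfrob : ∀ x : F, f (x ^ 2) = f x ^ 2) :
    Function.Injective (Cbarword f)
    ∧ (∀ v : F ⊕ Fin 2 → F, (∃ p : F × F × F, v = Cbarword f p) → v ≠ 0 →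
        2 ^ m - 1 ≤ wt v)
    ∧ (∃ v : F ⊕ Fin 2 → F, (∃ p : F × F × F, v = Cbarword f p) ∧ v ≠ 0 ∧
        wt v = 2 ^ m - 1)
    ∧ (∀ v : F ⊕ Fin 2 → F, (∀ p : F × F × F, ∑ i, v i * Cbarword f p i = 0) →
        v ≠ 0 → 3 ≤ wt v)
    ∧ (∃ v : F ⊕ Fin 2 → F, (∀ p : F × F × F, ∑ i, v i * Cbarword f p i = 0) ∧
        v ≠ 0 ∧ wt v = 3) := by
  have h2 : (2 : F) = 0 := two_eq_zero_of_card hcard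
  have hq : 2 ^ 3 ≤ 2 ^ m := Nat.pow_le_pow_right (by norm_num) hm
  have hf : IsOval f := isOval_of_bijective (by omega) hcard h2 f hoval
  have hline := hf.add_ne_one hmodd hcard h2 hf0 hf1 hfrob
  have hinj := Cbarword_injective f hf0
  have hzero : Cbarword f (0, 0, 0) = 0 := by
    ext i
    simp [Cbarword_apply]
  have hlower : ∀ v : F ⊕ Fin 2 → F, (∃ p : F × F × F, v = Cbarword f p) → v ≠ 0 →
      2 ^ m - 1 ≤ wt v := by
    rintro _ ⟨⟨a, b, c⟩, rfl⟩ hv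
    have hle := card_zeros_Cbarword_le_three hf h2 hline a b c (by
      rintro ⟨rfl, rfl, rfl⟩
      exact hv hzero)
    have hadd := wt_add_card_zeros (Cbarword f (a, b, c))
    omega
  obtain ⟨a, x, y, hyx, hx1, hy1, hx, hy⟩ :=
    hf.exists_secant (by omega) h2 hbij.injective hf0
  refine ⟨hinj, hlower, ⟨Cbarword f (a, 1, 1), ⟨_, rfl⟩, ?_, ?_⟩, ?_, ?_⟩
  · rw [← hzero]
    exact fun h => by simpa using hinj h
  · refine le_antisymm ?_ (hlower _ ⟨_, rfl⟩ ?_)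
    · have hadd := wt_add_card_zeros (Cbarword f (a, 1, 1))
      have htwo : 1 < (Finset.univ.filter fun x => a * f x + 1 * x + 1 = 0).card :=
        Finset.one_lt_card.mpr ⟨y, by simpa using hy, x, by simpa using hx, hyx⟩
      rw [card_zeros_Cbarword, if_pos (by linear_combination h2)] at hadd
      omega
    · rw [← hzero]
      exact fun h => by simpa using hinj h
  · intro v hv hv0
    simp only [Cbarword_apply] at hv
    exact three_le_wt_of_orthogonal _ (columnPoint_injective f hf0 hf1) v hv hv0
  · refine exists_orthogonal_wt_eq_three (a := a) ?_ hyx hx1 hy1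
      (by linear_combination hx - h2) (by linear_combination hy - h2)
    rintro rfl
    exact hx1 (by linear_combination hx - h2)
end
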